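/- arXiv:1810.05284 — 5 statements merged into one kernel-verified Lean document; each statement's English description precedes it below -/
import Mathlib

section
/- Suppose the LMI conditions (6) are feasible, i.e., there exist a symmetric positive definite P ∈ ℝ^{n×n}, a symmetric negative semidefinite X̂ ∈ ℝ^{m×m}, a symmetric positive definite Ẑ ∈ ℝ^{n×n}, and Ŷ ∈ ℝ^{m×n} satisfying them, and define X, Y, Z, F_o, R from this feasible solution. Then for every feedback gain F ∈ ℝ^{m×n} satisfying the ellipsoidal inclusion (F − F_o) Z (F − F_o)ᵀ ⪯ R, the closed-loop matrix A + B F is Hurwitz, i.e., every (complex) eigenvalue of A + B F has strictly negative real part. -/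
open Matrix

/-- **Lyapunov's criterion**: a real matrix `M` admitting a positive definite `P` with
`M P + P Mᵀ` negative definite is Hurwitz. -/
theorem Matrix.re_neg_of_mem_spectrum_of_lyapunov {ι : Type*} [Fintype ι] [DecidableEq ι]
    {M P : Matrix ι ι ℝ} (hP : P.PosDef) (hM : (-(M * P + P * Mᵀ)).PosDef)
    {μ : ℂ} (hμ : μ ∈ spectrum ℂ (M.map Complex.ofReal)) : μ.re < 0 := by
  rw [spectrum.mem_iff, Matrix.isUnit_iff_isUnit_det, isUnit_iff_ne_zero, not_not] at hμ
  obtain ⟨w, hw, hwM⟩ := Matrix.exists_vecMul_eq_zero_iff.mpr hμ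
  rw [Matrix.vecMul_sub, sub_eq_zero, Algebra.algebraMap_eq_smul_one, Matrix.vecMul_smul,
    Matrix.vecMul_one] at hwM
  set x : ι → ℝ := fun i => (w i).re with hx
  set y : ι → ℝ := fun i => (w i).im with hy
  have hxM : x ᵥ* M = μ.re • x - μ.im • y := by
    ext j
    have h := congrArg Complex.re (congrFun hwM j)
    simpa [Matrix.vecMul, dotProduct, hx, hy] using h.symm
  have hyM : y ᵥ* M = μ.re • y + μ.im • x := by
    ext j
    have h := congrArg Complex.im (congrFun hwM j)
    simpa [Matrix.vecMul, dotProduct, hx, hy] using h.symm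
  have hPt : Pᵀ = P := by simpa [IsHermitian, conjTranspose_eq_transpose_of_trivial] using hP.1
  have hcomm : ∀ u v : ι → ℝ, u ⬝ᵥ P *ᵥ v = v ⬝ᵥ P *ᵥ u := fun u v => by
    rw [dotProduct_mulVec, ← mulVec_transpose, hPt, dotProduct_comm]
  have hquad : ∀ v : ι → ℝ, v ⬝ᵥ (-(M * P + P * Mᵀ)) *ᵥ v = -2 * ((v ᵥ* M) ⬝ᵥ P *ᵥ v) := by
    intro v
    rw [neg_mulVec, add_mulVec, ← mulVec_mulVec, ← mulVec_mulVec, mulVec_transpose,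
      dotProduct_neg, dotProduct_add, dotProduct_mulVec v M, hcomm v (v ᵥ* M)]
    ring
  have hsum : x ⬝ᵥ (-(M * P + P * Mᵀ)) *ᵥ x + y ⬝ᵥ (-(M * P + P * Mᵀ)) *ᵥ y =
      -2 * μ.re * (x ⬝ᵥ P *ᵥ x + y ⬝ᵥ P *ᵥ y) := by
    rw [hquad, hquad, hxM, hyM]
    simp only [sub_dotProduct, add_dotProduct, smul_dotProduct, smul_eq_mul, hcomm y x]
    ring
  have hxy : x ≠ 0 ∨ y ≠ 0 := by
    by_contra! h
    exact hw (funext fun i => Complex.ext (congrFun h.1 i) (congrFun h.2 i))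
  have hpos : ∀ {N : Matrix ι ι ℝ}, N.PosDef → 0 < x ⬝ᵥ N *ᵥ x + y ⬝ᵥ N *ᵥ y := by
    intro N hN
    have hnonneg : ∀ v : ι → ℝ, 0 ≤ v ⬝ᵥ N *ᵥ v := fun v => by
      simpa using hN.posSemidef.dotProduct_mulVec_nonneg v
    have hpos' : ∀ v : ι → ℝ, v ≠ 0 → 0 < v ⬝ᵥ N *ᵥ v := fun v hv => by
      simpa using hN.dotProduct_mulVec_pos hv
    rcases hxy with h | h
    · exact add_pos_of_pos_of_nonneg (hpos' x h) (hnonneg y)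
    · exact add_pos_of_nonneg_of_pos (hnonneg x) (hpos' y h)
  have h := hpos hM
  rw [hsum] at h
  nlinarith [hpos hP]

/-- If the LMI conditions (6) are feasible, then every feedback gain `F`
inside the ellipsoid `(F − F_o) Z (F − F_o)ᵀ ⪯ R` renders `A + B F` Hurwitz. -/
theorem resilient_region_hurwitz {n m m_v p : ℕ}
    (A : Matrix (Fin n) (Fin n) ℝ) (B : Matrix (Fin n) (Fin m) ℝ)
    (Bv : Matrix (Fin n) (Fin m_v) ℝ) (C : Matrix (Fin p) (Fin n) ℝ)
    (Dgu : Matrix (Fin p) (Fin m) ℝ) (Dgv : Matrix (Fin p) (Fin m_v) ℝ)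
    (γ : ℝ) (hγ : 0 < γ)
    (P : Matrix (Fin n) (Fin n) ℝ) (Xh : Matrix (Fin m) (Fin m) ℝ)
    (Yh : Matrix (Fin m) (Fin n) ℝ) (Zh : Matrix (Fin n) (Fin n) ℝ)
    (hP : P.PosDef) (hXh : (-Xh).PosSemidef) (hZh : Zh.PosDef)
    (hLMI : (-(fromBlocks
        (A * P - B * Yh + (A * P - B * Yh)ᵀ - B * Xh * Bᵀ + Zh)
        ((C * P - Dgu * Xh * Bᵀ - Dgu * Yh)ᵀ)
        (C * P - Dgu * Xh * Bᵀ - Dgu * Yh)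
        (-(γ ^ 2) • (1 : Matrix (Fin p) (Fin p) ℝ) - Dgu * Xh * Dguᵀ)
        + fromRows Bv Dgv * (fromRows Bv Dgv)ᵀ)).PosDef)
    (F : Matrix (Fin m) (Fin n) ℝ)
    (hF : let X := Xh + Yh * Zh⁻¹ * Yhᵀ
          let Y := Yh * Zh⁻¹ * P
          let Z := P * Zh⁻¹ * P
          let Fo := -(Y * Z⁻¹)
          let R := Y * Z⁻¹ * Yᵀ - X
          (R - (F - Fo) * Z * (F - Fo)ᵀ).PosSemidef) :
    ∀ μ ∈ spectrum ℂ ((A + B * F).map (Complex.ofReal)), μ.re < 0 := by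
  intro μ hμ
  refine Matrix.re_neg_of_mem_spectrum_of_lyapunov hP ?_ hμ
  have hPt : Pᵀ = P := by simpa [IsHermitian, conjTranspose_eq_transpose_of_trivial] using hP.1
  have hZt : Zhᵀ = Zh := by simpa [IsHermitian, conjTranspose_eq_transpose_of_trivial] using hZh.1
  have hPu : IsUnit P.det := (isUnit_iff_isUnit_det P).mp hP.isUnit
  have hZu : IsUnit Zh.det := (isUnit_iff_isUnit_det Zh).mp hZh.isUnit
  have hZinv : (P * Zh⁻¹ * P)⁻¹ = P⁻¹ * Zh * P⁻¹ := by
    rw [Matrix.mul_inv_rev, Matrix.mul_inv_rev, nonsing_inv_nonsing_inv _ hZu, Matrix.mul_assoc]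
  have hYZ : Yh * Zh⁻¹ * P * (P⁻¹ * Zh * P⁻¹) = Yh * P⁻¹ := by
    simp only [Matrix.mul_assoc, mul_nonsing_inv_cancel_left _ _ hPu,
      nonsing_inv_mul_cancel_left _ _ hZu]
  have hR : Yh * P⁻¹ * (Yh * Zh⁻¹ * P)ᵀ = Yh * Zh⁻¹ * Yhᵀ := by
    simp only [transpose_mul, transpose_nonsing_inv, hPt, hZt, Matrix.mul_assoc,
      nonsing_inv_mul_cancel_left _ _ hPu]
  have hGP : (F + Yh * P⁻¹) * P = F * P + Yh := by
    rw [Matrix.add_mul, Matrix.mul_assoc, nonsing_inv_mul _ hPu, Matrix.mul_one]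
  have hquad : (F + Yh * P⁻¹) * (P * Zh⁻¹ * P) * (F + Yh * P⁻¹)ᵀ =
      (F * P + Yh) * Zh⁻¹ * (F * P + Yh)ᵀ := by
    rw [← hGP, transpose_mul, hPt]
    simp only [Matrix.mul_assoc]
  have hellipsoid : (-Xh - (F * P + Yh) * Zh⁻¹ * (F * P + Yh)ᵀ).PosSemidef := by
    simp only [hZinv, hYZ, hR, sub_neg_eq_add, hquad] at hF
    convert hF using 2
    abel
  have hblock := hLMI.submatrix (Sum.inl_injective (α := Fin n) (β := Fin p))
  have htopLeft : (-(A * P - B * Yh + (A * P - B * Yh)ᵀ - B * Xh * Bᵀ + Zh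
      + Bv * Bvᵀ)).PosDef := by
    convert hblock using 1
    ext i j
    simp [Matrix.mul_apply]
  have hBv : (Bv * Bvᵀ).PosSemidef := by
    simpa using posSemidef_self_mul_conjTranspose Bv
  have hB := hellipsoid.mul_mul_conjTranspose_same B
  have hsq := hZh.inv.posSemidef.mul_mul_conjTranspose_same (B * (F * P + Yh) - Zh)
  rw [conjTranspose_eq_transpose_of_trivial] at hB hsq
  have hexpand : (B * (F * P + Yh) - Zh) * Zh⁻¹ * (B * (F * P + Yh) - Zh)ᵀ =
      B * ((F * P + Yh) * Zh⁻¹ * (F * P + Yh)ᵀ) * Bᵀ - B * (F * P + Yh)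
        - (B * (F * P + Yh))ᵀ + Zh := by
    generalize F * P + Yh = G
    simp only [transpose_sub, transpose_mul, hZt, Matrix.sub_mul, Matrix.mul_sub,
      Matrix.mul_assoc, nonsing_inv_mul _ hZu, mul_nonsing_inv_cancel_left _ _ hZu,
      Matrix.mul_one]
    abel
  convert ((htopLeft.add_posSemidef hBv).add_posSemidef hB).add_posSemidef hsq using 1
  rw [hexpand]
  simp only [Matrix.add_mul, Matrix.mul_add, Matrix.mul_sub, Matrix.sub_mul, transpose_add,
    transpose_sub, transpose_mul, hPt, Matrix.mul_neg, Matrix.neg_mul, Matrix.mul_assoc]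
  abel
end

section
/- Suppose the LMI conditions (6) are feasible and define X, Y, Z, F_o, R from a feasible solution (P, X̂, Ŷ, Ẑ). Then for every feedback gain F ∈ ℝ^{m×n} satisfying (F − F_o) Z (F − F_o)ᵀ ⪯ R and for every frequency ω ∈ ℝ, the complex matrix iω·I − (A + BF) is invertible and the closed-loop frequency response satisfies ‖(C + D_gu F)(iω·I − (A + BF))⁻¹ B_v + D_gv‖ ≤ γ, where ‖·‖ denotes the ℓ²→ℓ² operator norm of the complex matrix (its maximum singular value). -/
open Matrix

/-- The ℓ²→ℓ² operator norm (maximum singular value) of a complex matrix. -/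
noncomputable def l2OpNorm {p q : ℕ} (M : Matrix (Fin p) (Fin q) ℂ) : ℝ :=
  ‖LinearMap.toContinuousLinearMap (Matrix.toEuclideanLin M)‖

open scoped ComplexOrder in
/-- A real positive definite matrix stays positive definite over the complex numbers. -/
theorem Matrix.PosDef.map_ofReal {ι : Type*} [Fintype ι]
    {M : Matrix ι ι ℝ} (hM : M.PosDef) : (M.map Complex.ofReal).PosDef := by
  classical
  obtain ⟨N, hN⟩ : ∃ N : Matrix ι ι ℝ, M = Nᴴ * N := by
    open scoped MatrixOrder in
    exact CStarAlgebra.nonneg_iff_eq_star_mul_self.mp hM.posSemidef.nonneg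
  have hmap : M.map Complex.ofReal = (N.map Complex.ofReal)ᴴ * N.map Complex.ofReal := by
    rw [hN]
    ext i j
    simp [Matrix.mul_apply]
  have hpos : (M.map Complex.ofReal).PosSemidef := by
    rw [hmap]
    exact posSemidef_conjTranspose_mul_self _
  exact hpos.posDef_iff_isUnit.mpr (hM.isUnit.map (RingHom.mapMatrix Complex.ofRealHom))

open scoped ComplexOrder in
theorem l2OpNorm_le_of_posSemidef {p q : ℕ} {G : Matrix (Fin p) (Fin q) ℂ} {γ : ℝ} (hγ : 0 ≤ γ)
    (h : (((γ : ℂ) ^ 2) • (1 : Matrix (Fin p) (Fin p) ℂ) - G * Gᴴ).PosSemidef) :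
    l2OpNorm G ≤ γ := by
  have hadj : l2OpNorm G = l2OpNorm Gᴴ := (l2_opNorm_conjTranspose G).symm
  rw [hadj]
  refine ContinuousLinearMap.opNorm_le_bound _ hγ fun y ↦ ?_
  refine (sq_le_sq₀ (norm_nonneg _) (by positivity)).mp ?_
  have hy := h.dotProduct_mulVec_nonneg (WithLp.ofLp y)
  rw [sub_mulVec, dotProduct_sub, smul_mulVec, one_mulVec, dotProduct_smul, ← mulVec_mulVec,
    dotProduct_mulVec _ G] at hy
  have hG : star (WithLp.ofLp y) ᵥ* G = star (Gᴴ *ᵥ WithLp.ofLp y) := by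
    rw [star_mulVec, conjTranspose_conjTranspose]
  have hnorm {k : ℕ} (v : Fin k → ℂ) :
      star v ⬝ᵥ v = ((‖WithLp.toLp 2 v‖ ^ 2 : ℝ) : ℂ) := by
    rw [EuclideanSpace.norm_sq_eq, dotProduct]
    push_cast
    exact Finset.sum_congr rfl fun i _ ↦ Complex.conj_mul' _
  rw [hG, hnorm, hnorm, smul_eq_mul, sub_nonneg] at hy
  rw [mul_pow]
  exact_mod_cast hy

open scoped ComplexOrder in
theorem isUnit_of_lyapunov_posDef {ι : Type*} [Fintype ι] [DecidableEq ι] {S P : Matrix ι ι ℂ}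
    (h : (S * P + P * Sᴴ).PosDef) : IsUnit S := by
  rw [isUnit_iff_isUnit_det, isUnit_iff_ne_zero]
  intro hdet
  obtain ⟨v, hv, hvS⟩ := exists_vecMul_eq_zero_iff.mpr hdet
  have hpos := h.dotProduct_mulVec_pos (star_ne_zero.mpr hv)
  have hSv : Sᴴ *ᵥ star v = 0 := by rw [← star_vecMul, hvS, star_zero]
  simp [add_mulVec, ← mulVec_mulVec, hSv, dotProduct_mulVec v S, hvS] at hpos

open scoped ComplexOrder in
/-- The pointwise bounded real lemma: a dissipation inequality for the pencil value `S` makes `S`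
invertible and bounds the frequency response. -/
theorem isUnit_and_l2OpNorm_le_of_dissipation {n q p : ℕ} {S P : Matrix (Fin n) (Fin n) ℂ}
    {B : Matrix (Fin n) (Fin q) ℂ} {C : Matrix (Fin p) (Fin n) ℂ} {D : Matrix (Fin p) (Fin q) ℂ}
    {γ : ℝ} (hγ : 0 ≤ γ)
    (h : (fromBlocks (S * P + P * Sᴴ) (-(P * Cᴴ)) (-(C * P))
        (((γ : ℂ) ^ 2) • (1 : Matrix (Fin p) (Fin p) ℂ))
        - fromRows B D * (fromRows B D)ᴴ).PosDef) :
    IsUnit S ∧ l2OpNorm (C * S⁻¹ * B + D) ≤ γ := by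
  have hS : IsUnit S := by
    have h₁₁ := (h.add_posSemidef (posSemidef_self_mul_conjTranspose (fromRows B D))).submatrix
      (Sum.inl_injective (α := Fin n) (β := Fin p))
    rw [sub_add_cancel] at h₁₁
    exact isUnit_of_lyapunov_posDef (P := P) h₁₁
  refine ⟨hS, l2OpNorm_le_of_posSemidef hγ ?_⟩
  have hTS : C * S⁻¹ * S = C := by
    rw [Matrix.mul_assoc, nonsing_inv_mul _ ((isUnit_iff_isUnit_det S).mp hS), Matrix.mul_one]
  have hST : Sᴴ * (C * S⁻¹)ᴴ = Cᴴ := by rw [← conjTranspose_mul, hTS]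
  generalize C * S⁻¹ = T at hTS hST ⊢
  convert! h.posSemidef.mul_mul_conjTranspose_same (fromCols T (1 : Matrix (Fin p) (Fin p) ℂ))
    using 1
  have hG : fromCols T (1 : Matrix (Fin p) (Fin p) ℂ) * fromRows B D = T * B + D := by
    rw [fromCols_mul_fromRows, Matrix.one_mul]
  rw [Matrix.mul_sub, Matrix.sub_mul, ← Matrix.mul_assoc, hG, Matrix.mul_assoc (T * B + D),
    ← conjTranspose_mul, hG, fromCols_mul_fromBlocks,
    conjTranspose_fromCols_eq_fromRows_conjTranspose,
    fromCols_mul_fromRows]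
  congr 1
  simp only [Matrix.mul_add, Matrix.add_mul, Matrix.mul_neg, Matrix.neg_mul, Matrix.one_mul,
    Matrix.mul_one, conjTranspose_one, ← Matrix.mul_assoc, hTS]
  rw [Matrix.mul_assoc (T * P) Sᴴ, hST]
  abel

/-- Completion of squares: the ellipsoidal constraint lets the gain perturbation `W` replace the
multiplier terms of the LMI. -/
theorem Matrix.PosDef.closed_loop_of_multiplier {ι κ μ : Type*} [Fintype ι] [Fintype κ] [Fintype μ]
    [DecidableEq κ] {N : Matrix ι ι ℝ} {E : Matrix ι μ ℝ} {J : Matrix ι κ ℝ}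
    {X : Matrix μ μ ℝ} {Z : Matrix κ κ ℝ} {W : Matrix μ κ ℝ}
    (hN : N.PosDef) (hZ : Z.PosDef) (hW : (-X - W * Z⁻¹ * Wᵀ).PosSemidef) :
    (N - E * X * Eᵀ + J * Z * Jᵀ - E * W * Jᵀ - J * Wᵀ * Eᵀ).PosDef := by
  have hZu : IsUnit Z.det := (isUnit_iff_isUnit_det Z).mp hZ.isUnit
  have hZt : Zᵀ = Z := hZ.isHermitian
  have h₁ := hW.mul_mul_conjTranspose_same E
  have h₂ := hZ.inv.posSemidef.mul_mul_conjTranspose_same (J * Z - E * W)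
  convert! hN.add_posSemidef (h₁.add h₂) using 1
  simp only [conjTranspose_eq_transpose_of_trivial, transpose_sub, transpose_mul, hZt,
    Matrix.sub_mul, Matrix.mul_sub, Matrix.mul_neg, Matrix.neg_mul, Matrix.mul_assoc]
  simp only [mul_nonsing_inv_cancel_left _ _ hZu, nonsing_inv_mul_cancel_left _ _ hZu]
  abel

/-- If the LMI conditions (6) are feasible, then every feedback gain `F`
inside the ellipsoid `(F − F_o) Z (F − F_o)ᵀ ⪯ R` achieves the γ-level H∞ disturbance
attenuation: for every frequency ω the matrix `iω I − (A + BF)` is invertible and the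
frequency response has operator norm at most γ. -/
theorem resilient_region_Hinf {n m m_v p : ℕ}
    (A : Matrix (Fin n) (Fin n) ℝ) (B : Matrix (Fin n) (Fin m) ℝ)
    (Bv : Matrix (Fin n) (Fin m_v) ℝ) (C : Matrix (Fin p) (Fin n) ℝ)
    (Dgu : Matrix (Fin p) (Fin m) ℝ) (Dgv : Matrix (Fin p) (Fin m_v) ℝ)
    (γ : ℝ) (hγ : 0 < γ)
    (P : Matrix (Fin n) (Fin n) ℝ) (Xh : Matrix (Fin m) (Fin m) ℝ)
    (Yh : Matrix (Fin m) (Fin n) ℝ) (Zh : Matrix (Fin n) (Fin n) ℝ)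
    (hP : P.PosDef) (hXh : (-Xh).PosSemidef) (hZh : Zh.PosDef)
    (hLMI : (-(fromBlocks
        (A * P - B * Yh + (A * P - B * Yh)ᵀ - B * Xh * Bᵀ + Zh)
        ((C * P - Dgu * Xh * Bᵀ - Dgu * Yh)ᵀ)
        (C * P - Dgu * Xh * Bᵀ - Dgu * Yh)
        (-(γ ^ 2) • (1 : Matrix (Fin p) (Fin p) ℝ) - Dgu * Xh * Dguᵀ)
        + fromRows Bv Dgv * (fromRows Bv Dgv)ᵀ)).PosDef)
    (F : Matrix (Fin m) (Fin n) ℝ)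
    (hF : let X := Xh + Yh * Zh⁻¹ * Yhᵀ
          let Y := Yh * Zh⁻¹ * P
          let Z := P * Zh⁻¹ * P
          let Fo := -(Y * Z⁻¹)
          let R := Y * Z⁻¹ * Yᵀ - X
          (R - (F - Fo) * Z * (F - Fo)ᵀ).PosSemidef) :
    ∀ ω : ℝ,
      IsUnit (((ω : ℂ) * Complex.I) • (1 : Matrix (Fin n) (Fin n) ℂ)
          - (A + B * F).map Complex.ofReal) ∧
      l2OpNorm ((C + Dgu * F).map Complex.ofReal
          * (((ω : ℂ) * Complex.I) • (1 : Matrix (Fin n) (Fin n) ℂ)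
              - (A + B * F).map Complex.ofReal)⁻¹
          * Bv.map Complex.ofReal + Dgv.map Complex.ofReal) ≤ γ := by
  intro ω
  have hPu : IsUnit P.det := (isUnit_iff_isUnit_det P).mp hP.isUnit
  have hPt : Pᵀ = P := hP.isHermitian
  have hZt : Zhᵀ = Zh := hZh.isHermitian
  have hXt : Xhᵀ = Xh := by
    have h : (-Xh)ᵀ = -Xh := hXh.isHermitian
    rwa [transpose_neg, neg_inj] at h
  have hZu : IsUnit Zh.det := (isUnit_iff_isUnit_det Zh).mp hZh.isUnit
  have hYZ : Yh * Zh⁻¹ * P * (P * Zh⁻¹ * P)⁻¹ = Yh * P⁻¹ := by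
    rw [Matrix.mul_inv_rev, Matrix.mul_inv_rev, nonsing_inv_nonsing_inv _ hZu]
    simp only [Matrix.mul_assoc, mul_nonsing_inv_cancel_left _ _ hPu,
      nonsing_inv_mul_cancel_left _ _ hZu]
  have hW : (-Xh - (F * P + Yh) * Zh⁻¹ * (F * P + Yh)ᵀ).PosSemidef := by
    have hFP : (F - -(Yh * P⁻¹)) * P = F * P + Yh := by
      rw [sub_neg_eq_add, Matrix.add_mul, Matrix.mul_assoc Yh, nonsing_inv_mul _ hPu,
        Matrix.mul_one]
    convert! hF using 1
    simp only [hYZ]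
    rw [← hFP]
    simp only [transpose_mul, transpose_nonsing_inv, hPt, hZt, Matrix.mul_assoc,
      nonsing_inv_mul_cancel_left _ _ hPu]
    abel
  have hK := hLMI.closed_loop_of_multiplier (E := fromRows B Dgu)
    (J := fromRows (1 : Matrix (Fin n) (Fin n) ℝ) (0 : Matrix (Fin p) (Fin n) ℝ)) hZh hW
  refine isUnit_and_l2OpNorm_le_of_dissipation (P := P.map Complex.ofReal) hγ.le ?_
  convert! hK.map_ofReal using 1
  have hreal : -(fromBlocks
        (A * P - B * Yh + (A * P - B * Yh)ᵀ - B * Xh * Bᵀ + Zh)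
        ((C * P - Dgu * Xh * Bᵀ - Dgu * Yh)ᵀ)
        (C * P - Dgu * Xh * Bᵀ - Dgu * Yh)
        (-(γ ^ 2) • (1 : Matrix (Fin p) (Fin p) ℝ) - Dgu * Xh * Dguᵀ)
        + fromRows Bv Dgv * (fromRows Bv Dgv)ᵀ)
      - fromRows B Dgu * Xh * (fromRows B Dgu)ᵀ
      + fromRows (1 : Matrix (Fin n) (Fin n) ℝ) (0 : Matrix (Fin p) (Fin n) ℝ) * Zh
        * (fromRows (1 : Matrix (Fin n) (Fin n) ℝ) (0 : Matrix (Fin p) (Fin n) ℝ))ᵀ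
      - fromRows B Dgu * (F * P + Yh)
        * (fromRows (1 : Matrix (Fin n) (Fin n) ℝ) (0 : Matrix (Fin p) (Fin n) ℝ))ᵀ
      - fromRows (1 : Matrix (Fin n) (Fin n) ℝ) (0 : Matrix (Fin p) (Fin n) ℝ) * (F * P + Yh)ᵀ
        * (fromRows B Dgu)ᵀ
      = fromBlocks (-((A + B * F) * P + P * (A + B * F)ᵀ)) (-(P * (C + Dgu * F)ᵀ))
          (-((C + Dgu * F) * P)) (γ ^ 2 • (1 : Matrix (Fin p) (Fin p) ℝ))
        - fromRows Bv Dgv * (fromRows Bv Dgv)ᵀ := by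
    generalize fromRows Bv Dgv * (fromRows Bv Dgv)ᵀ = L
    rw [neg_add_rev, sub_eq_add_neg _ L, add_comm _ (-L)]
    simp only [add_assoc, sub_eq_add_neg]
    congr 1
    simp only [transpose_fromRows, fromRows_mul, mul_fromCols,
      fromCols_fromRows_eq_fromBlocks, fromBlocks_neg, fromBlocks_add]
    congr 1 <;>
    simp only [transpose_add, transpose_mul, transpose_transpose, transpose_neg, transpose_one,
      transpose_zero, hXt, hPt, Matrix.add_mul, Matrix.mul_add,
      Matrix.mul_one, Matrix.one_mul, Matrix.mul_zero,
      Matrix.zero_mul, Matrix.mul_assoc, neg_smul] <;>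
    abel
  rw [hreal]
  generalize A + B * F = Acl
  generalize C + Dgu * F = Ccl
  have hadj {k l : ℕ} (M : Matrix (Fin k) (Fin l) ℝ) :
      (M.map Complex.ofReal)ᴴ = Mᵀ.map Complex.ofReal := by
    ext i j
    simp
  have hmul {j k l : ℕ} (M : Matrix (Fin j) (Fin k) ℝ) (N : Matrix (Fin k) (Fin l) ℝ) :
      (M * N).map Complex.ofReal = M.map Complex.ofReal * N.map Complex.ofReal :=
    Matrix.map_mul (f := Complex.ofRealHom)
  have hL : fromRows (Bv.map Complex.ofReal) (Dgv.map Complex.ofReal)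
        * (fromRows (Bv.map Complex.ofReal) (Dgv.map Complex.ofReal))ᴴ
      = (fromRows Bv Dgv * (fromRows Bv Dgv)ᵀ).map Complex.ofReal := by
    ext i j
    rcases i with i | i <;> rcases j with j | j <;> simp [Matrix.mul_apply]
  rw [hL, Matrix.map_sub _ Complex.ofReal_sub, fromBlocks_map]
  congr 2
  · rw [Matrix.map_neg _ Complex.ofReal_neg, Matrix.map_add _ Complex.ofReal_add, hmul, hmul,
      conjTranspose_sub, conjTranspose_smul, hadj, conjTranspose_one, Matrix.sub_mul,
      Matrix.mul_sub, smul_mul_assoc, mul_smul_comm, Matrix.one_mul, Matrix.mul_one]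
    have hω : star ((ω : ℂ) * Complex.I) = -((ω : ℂ) * Complex.I) := by simp
    rw [hω, neg_smul]
    abel
  · rw [Matrix.map_neg _ Complex.ofReal_neg, hmul, hadj]
  · rw [Matrix.map_neg _ Complex.ofReal_neg, hmul]
  · ext i j
    by_cases hij : i = j <;> simp [hij]
end

section
/- Let A ∈ ℝ^{n×n}, B ∈ ℝ^{n×m}, Ŷ ∈ ℝ^{m×n}, let P ∈ ℝ^{n×n} and Ẑ ∈ ℝ^{n×n} be symmetric positive definite, and let X̂ ∈ ℝ^{m×m} be symmetric negative semidefinite. If Q₁₁ := AP − BŶ + (AP − BŶ)ᵀ − B X̂ Bᵀ + Ẑ is negative definite, then with F_o := −Ŷ P⁻¹ the Lyapunov inequality (A + B F_o) P + P (A + B F_o)ᵀ ≺ 0 holds, i.e., (A + B F_o) P + P (A + B F_o)ᵀ is negative definite. -/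
open Matrix

/-- If the (1,1) block `Q₁₁` of the LMI (6) is negative definite, then the
central controller `F_o = −Ŷ P⁻¹` satisfies the Lyapunov inequality
`(A + B F_o) P + P (A + B F_o)ᵀ ≺ 0`. -/
theorem central_controller_lyapunov {n m : ℕ}
    (A : Matrix (Fin n) (Fin n) ℝ) (B : Matrix (Fin n) (Fin m) ℝ)
    (Yh : Matrix (Fin m) (Fin n) ℝ)
    (P Zh : Matrix (Fin n) (Fin n) ℝ) (Xh : Matrix (Fin m) (Fin m) ℝ)
    (hP : P.PosDef) (hZh : Zh.PosDef) (hXh : (-Xh).PosSemidef)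
    (hQ11 : (-(A * P - B * Yh + (A * P - B * Yh)ᵀ - B * Xh * Bᵀ + Zh)).PosDef) :
    (-((A + B * (-(Yh * P⁻¹))) * P + P * (A + B * (-(Yh * P⁻¹)))ᵀ)).PosDef := by
  have hPT : Pᵀ = P := hP.isHermitian
  have hdet : IsUnit P.det := (Matrix.isUnit_iff_isUnit_det P).mp hP.isUnit
  have hcl : (A + B * (-(Yh * P⁻¹))) * P = A * P - B * Yh := by
    rw [Matrix.add_mul, Matrix.mul_neg, Matrix.neg_mul, Matrix.mul_assoc B, Matrix.mul_assoc Yh,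
      Matrix.nonsing_inv_mul P hdet, Matrix.mul_one, sub_eq_add_neg]
  have hclT : P * (A + B * (-(Yh * P⁻¹)))ᵀ = (A * P - B * Yh)ᵀ := by
    rw [← hcl, Matrix.transpose_mul, hPT]
  have hX : (B * (-Xh) * Bᵀ).PosSemidef := by
    simpa only [Matrix.conjTranspose_eq_transpose_of_trivial] using
      hXh.mul_mul_conjTranspose_same B
  rw [hcl, hclT]
  convert (hQ11.add_posSemidef hX).add hZh using 1
  rw [Matrix.mul_neg, Matrix.neg_mul]
  abel
end

section
/- Let Z ∈ ℝ^{n×n} be symmetric positive semidefinite, let R ∈ ℝ^{m×m} be symmetric, let A, B ∈ ℝ^{m×n}, and let α, β > 0 be real numbers. If A Z Aᵀ ⪯ α²·R and B Z Bᵀ ⪯ β²·R, then (A + B) Z (A + B)ᵀ ⪯ (α + β)²·R. -/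
open Matrix

/-- Triangle-type inequality for the ellipsoidal constraint: if
`A Z Aᵀ ⪯ α² R` and `B Z Bᵀ ⪯ β² R` with `α, β > 0`, then
`(A + B) Z (A + B)ᵀ ⪯ (α + β)² R`. -/
theorem triangle_type_inequality {n m : ℕ}
    (Z : Matrix (Fin n) (Fin n) ℝ) (hZ : Z.PosSemidef)
    (R : Matrix (Fin m) (Fin m) ℝ) (hR : R.IsSymm)
    (A B : Matrix (Fin m) (Fin n) ℝ) (α β : ℝ) (hα : 0 < α) (hβ : 0 < β)
    (hA : (α ^ 2 • R - A * Z * Aᵀ).PosSemidef)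
    (hB : (β ^ 2 • R - B * Z * Bᵀ).PosSemidef) :
    ((α + β) ^ 2 • R - (A + B) * Z * (A + B)ᵀ).PosSemidef := by
  have hC := hZ.mul_mul_conjTranspose_same (β • A - α • B)
  rw [conjTranspose_eq_transpose_of_trivial] at hC
  have key : (α + β) ^ 2 • R - (A + B) * Z * (A + B)ᵀ =
      ((α + β) / α) • (α ^ 2 • R - A * Z * Aᵀ) + ((α + β) / β) • (β ^ 2 • R - B * Z * Bᵀ) +
        (1 / (α * β)) • ((β • A - α • B) * Z * (β • A - α • B)ᵀ) := by
    simp only [transpose_add, transpose_sub, transpose_smul, Matrix.add_mul, Matrix.mul_add,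
      Matrix.sub_mul, Matrix.mul_sub, Matrix.smul_mul, Matrix.mul_smul]
    match_scalars <;> field_simp <;> ring
  rw [key]
  exact ((hA.smul (by positivity)).add (hB.smul (by positivity))).add (hC.smul (by positivity))
end

section
/- Let Z ∈ ℝ^{n×n} be symmetric positive semidefinite, let R ∈ ℝ^{m×m} be symmetric, let F_o, F, ΔF ∈ ℝ^{m×n}, and let θ ∈ (0,1). If the sparse design F satisfies (F − F_o) Z (F − F_o)ᵀ ⪯ θ·R and the perturbation ΔF satisfies ΔF Z ΔFᵀ ⪯ (1 − √θ)²·R, then the perturbed controller F + ΔF remains in the full ellipsoid: (F + ΔF − F_o) Z (F + ΔF − F_o)ᵀ ⪯ R. -/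
open Matrix

/-- The weighted identity behind the triangle inequality for the seminorm induced by `Z`. -/
lemma sub_quadratic_add_eq {n m : ℕ} (Z : Matrix (Fin n) (Fin n) ℝ)
    (R : Matrix (Fin m) (Fin m) ℝ) (X Y : Matrix (Fin m) (Fin n) ℝ)
    {s t : ℝ} (hs : s ≠ 0) (ht : t ≠ 0) (hst : s + t = 1) :
    R - (X + Y) * Z * (X + Y)ᵀ =
      s⁻¹ • (s ^ 2 • R - X * Z * Xᵀ) + t⁻¹ • (t ^ 2 • R - Y * Z * Yᵀ) +
        (s * t)⁻¹ • ((t • X - s • Y) * Z * (t • X - s • Y)ᵀ) := by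
  simp only [transpose_add, transpose_sub, transpose_smul, Matrix.add_mul, Matrix.mul_add,
    Matrix.sub_mul, Matrix.mul_sub, Matrix.smul_mul, Matrix.mul_smul]
  obtain rfl : t = 1 - s := by linarith
  match_scalars <;> field_simp <;> ring

/-- Resilience margin of a sparse design: if
`(F − F_o) Z (F − F_o)ᵀ ⪯ θ R` with `θ ∈ (0,1)` and the perturbation satisfies
`ΔF Z ΔFᵀ ⪯ (1 − √θ)² R`, then the perturbed controller stays in the full ellipsoid:
`(F + ΔF − F_o) Z (F + ΔF − F_o)ᵀ ⪯ R`. -/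
theorem resilience_margin {n m : ℕ}
    (Z : Matrix (Fin n) (Fin n) ℝ) (hZ : Z.PosSemidef)
    (R : Matrix (Fin m) (Fin m) ℝ) (hR : R.IsSymm)
    (Fo F ΔF : Matrix (Fin m) (Fin n) ℝ)
    (θ : ℝ) (hθ : θ ∈ Set.Ioo (0 : ℝ) 1)
    (hF : (θ • R - (F - Fo) * Z * (F - Fo)ᵀ).PosSemidef)
    (hΔF : ((1 - Real.sqrt θ) ^ 2 • R - ΔF * Z * ΔFᵀ).PosSemidef) :
    (R - (F + ΔF - Fo) * Z * (F + ΔF - Fo)ᵀ).PosSemidef := by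
  obtain ⟨hθ0, hθ1⟩ := hθ
  have hs : 0 < √θ := Real.sqrt_pos.2 hθ0
  have ht : 0 < 1 - √θ := sub_pos.2 ((Real.sqrt_lt' one_pos).2 (by simpa using hθ1))
  have hsq : √θ ^ 2 = θ := Real.sq_sqrt hθ0.le
  rw [add_sub_right_comm,
    sub_quadratic_add_eq Z R (F - Fo) ΔF hs.ne' ht.ne' (add_sub_cancel _ _), hsq]
  have hcross := hZ.mul_mul_conjTranspose_same ((1 - √θ) • (F - Fo) - √θ • ΔF)
  rw [conjTranspose_eq_transpose_of_trivial] at hcross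
  exact ((hF.smul (inv_nonneg.2 hs.le)).add (hΔF.smul (inv_nonneg.2 ht.le))).add
    (hcross.smul (inv_nonneg.2 (mul_pos hs ht).le))
end
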